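/- arXiv:0903.0898 — 2 statements merged into one kernel-verified Lean document; each statement's English description precedes it below -/
import Mathlib

section
/- The number of permutations of length 2n avoiding the classical pattern 123 among even values placed in odd positions equals the sum over k from 0 to n of n!·(n−k)!·C(n,k)^3·C_k, where C_k is the k-th Catalan number. -/
open Finset

/-- Ballot numbers. -/
def ballot : ℕ → ℕ → ℕ
  | 0, _ => 1
  | a + 1, 0 => ballot a 1
  | a + 1, b + 1 => ballot (a + 1) b + ballot a (b + 2)
termination_by a b => (a, b)

theorem ballot_zero_left (b : ℕ) : ballot 0 b = 1 := by rw [ballot]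

theorem ballot_succ_zero (a : ℕ) : ballot (a + 1) 0 = ballot a 1 := by rw [ballot]

theorem ballot_succ_succ (a b : ℕ) :
    ballot (a + 1) (b + 1) = ballot (a + 1) b + ballot a (b + 2) := by rw [ballot]

theorem sum_range_ballot (a b : ℕ) :
    ∑ i ∈ range (a + 1), ballot i (a + b - i) = ballot a (b + 1) := by
  induction a generalizing b with
  | zero => simp [ballot_zero_left]
  | succ a ih =>
    rw [sum_range_succ, ballot_succ_succ, ← ih (b + 1), add_comm]
    congr 1
    · congr 1; omega
    · exact sum_congr rfl fun i _ => by congr 1; omega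

theorem ballot_mul_factorial (a b : ℕ) :
    ballot a b * (a.factorial * (a + b + 1).factorial) = (b + 1) * (2 * a + b).factorial := by
  induction a generalizing b with
  | zero => simp [ballot_zero_left, Nat.factorial_succ]
  | succ a iha =>
    induction b with
    | zero =>
      have h := iha 1
      rw [ballot_succ_zero]
      have e : 2 * (a + 1) + 0 = (2 * a + 1) + 1 := by ring
      rw [e, Nat.factorial_succ (2 * a + 1), Nat.factorial_succ a]
      have e' : a + 1 + 0 + 1 = a + 1 + 1 := by ring
      rw [e']
      linear_combination (a + 1) * h
    | succ b ihb =>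
      have h := iha (b + 2)
      rw [ballot_succ_succ]
      have e : 2 * (a + 1) + (b + 1) = (2 * a + (b + 2)) + 1 := by ring
      have e' : a + 1 + (b + 1) + 1 = a + b + 2 + 1 := by ring
      have e1 : a + (b + 2) + 1 = a + b + 2 + 1 := by ring
      have e2 : a + 1 + b + 1 = a + b + 2 := by ring
      have e3 : 2 * (a + 1) + b = 2 * a + (b + 2) := by ring
      rw [e1, Nat.factorial_succ (a + b + 2)] at h
      rw [e2, e3, Nat.factorial_succ a] at ihb
      rw [e, e', Nat.factorial_succ (2 * a + (b + 2)), Nat.factorial_succ (a + b + 2),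
        Nat.factorial_succ a]
      linear_combination (a + 1) * h + (a + b + 2 + 1) * ihb

theorem ballot_zero_right (n : ℕ) : ballot n 0 = catalan n := by
  have h := ballot_mul_factorial n 0
  have h1 := succ_mul_catalan_eq_centralBinom n
  have h2 := Nat.choose_mul_factorial_mul_factorial (show n ≤ 2 * n by omega)
  rw [Nat.centralBinom] at h1
  rw [show 2 * n - n = n by omega, ← h1] at h2
  simp only [Nat.add_zero, zero_add, one_mul, Nat.factorial_succ n] at h
  have : 0 < n.factorial * ((n + 1) * n.factorial) := by positivity
  exact Nat.eq_of_mul_eq_mul_right this (by rw [h, ← h2]; ring)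

theorem sum_card_filter_lt {α : Type*} [LinearOrder α] (S : Finset α) (φ : ℕ → ℕ) :
    ∑ x ∈ S, φ #{y ∈ S | y < x} = ∑ i ∈ range #S, φ i := by
  induction S using Finset.induction_on_max with
  | empty => simp
  | insert a S h ih =>
    have ha : a ∉ S := fun h' => lt_irrefl _ (h a h')
    rw [sum_insert ha, card_insert_of_notMem ha, sum_range_succ, ← ih, add_comm]
    congr 1
    · refine sum_congr rfl fun x hx => ?_
      rw [filter_insert, if_neg (h x hx).not_gt]
    · rw [filter_insert, if_neg (lt_irrefl a), filter_true_of_mem h]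

/-- `l` has no subsequence of three increasing entries. -/
def Avoids123 {α : Type*} [LT α] (l : List α) : Prop :=
  l.Triplewise fun a b c => ¬ (a < b ∧ b < c)

/-- The lists enumerating each element of `S` exactly once. -/
def arrangements {α : Type*} [DecidableEq α] (S : Finset α) : Finset (List α) :=
  S.val.lists.toFinset

theorem mem_arrangements {α : Type*} [DecidableEq α] {S : Finset α} {l : List α} :
    l ∈ arrangements S ↔ l.Nodup ∧ l.toFinset = S := by
  rw [arrangements, Multiset.mem_toFinset, Multiset.mem_lists_iff]
  constructor
  · intro h
    have hn : l.Nodup := by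
      have := S.nodup
      rw [h] at this
      exact Multiset.coe_nodup.1 this
    refine ⟨hn, ?_⟩
    apply Finset.val_injective
    rw [List.toFinset_val, hn.dedup, h]
    rfl
  · rintro ⟨hn, rfl⟩
    rw [List.toFinset_val, hn.dedup]
    rfl

theorem card_filter_arrangements {α : Type*} [DecidableEq α] {S : Finset α} (hS : S.Nonempty)
    (P : List α → Prop) [DecidablePred P] :
    #{l ∈ arrangements S | P l} = ∑ x ∈ S, #{l ∈ arrangements (S.erase x) | P (x :: l)} := by
  rw [← card_sigma]
  symm
  refine card_bij (fun p _ => p.1 :: p.2) ?_ ?_ ?_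
  · rintro ⟨x, l⟩ h
    simp only [mem_sigma, mem_filter, mem_arrangements] at h ⊢
    obtain ⟨hx, ⟨hn, hl⟩, hP⟩ := h
    have : x ∉ l := fun h' => by
      rw [← List.mem_toFinset, hl] at h'
      simp at h'
    exact ⟨⟨List.nodup_cons.2 ⟨this, hn⟩, by rw [List.toFinset_cons, hl, insert_erase hx]⟩, hP⟩
  · rintro ⟨x, l⟩ _ ⟨y, l'⟩ _ h
    simp only [List.cons.injEq] at h
    obtain ⟨rfl, rfl⟩ := h
    rfl
  · intro l h
    simp only [mem_filter, mem_arrangements] at h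
    obtain ⟨⟨hn, rfl⟩, hP⟩ := h
    cases l with
    | nil => simp at hS
    | cons x l =>
      refine ⟨⟨x, l⟩, ?_, rfl⟩
      rw [List.nodup_cons] at hn
      simp only [mem_sigma, mem_filter, mem_arrangements]
      exact ⟨by simp, ⟨hn.2, by
        rw [List.toFinset_cons, erase_insert (by simpa using hn.1)]⟩, hP⟩

section
variable {α : Type*} [LinearOrder α]

theorem avoids123_cons_cons_of_lt {m x : α} (h : x < m) (l : List α) :
    Avoids123 (m :: x :: l) ↔ Avoids123 (x :: l) := by
  simp only [Avoids123, List.triplewise_cons, List.pairwise_cons, and_iff_right_iff_imp]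
  rintro ⟨h1, -⟩
  refine ⟨fun a _ h' => lt_asymm h h'.1, h1.imp ?_⟩
  exact fun hab h' => hab ⟨h.trans h'.1, h'.2⟩

theorem avoids123_cons_cons_of_gt {m x : α} (h : m < x) (l : List α) :
    Avoids123 (m :: x :: l) ↔ (∀ y ∈ l, y ≤ x) ∧ Avoids123 (m :: l) := by
  simp only [Avoids123, List.triplewise_cons, List.pairwise_cons]
  constructor
  · rintro ⟨⟨h1, h2⟩, h3, h4⟩
    exact ⟨fun y hy => not_lt.1 fun h' => h1 y hy ⟨h, h'⟩, h2, h4⟩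
  · rintro ⟨h1, h2, h3⟩
    refine ⟨⟨fun y hy h' => (h1 y hy).not_gt h'.2, h2⟩, ?_, h3⟩
    exact h2.imp fun hab h' => hab ⟨h.trans h'.1, h'.2⟩

theorem sum_ballot_card_erase {S : Finset α} (L : Finset α) (hL : L ⊆ S)
    (hlow : ∀ x ∈ L, ∀ y ∈ S, y < x → y ∈ L) :
    ∑ x ∈ L, ballot #{y ∈ S.erase x | y < x} #{y ∈ S.erase x | x < y} =
      ∑ i ∈ range #L, ballot i (#S - 1 - i) := by
  rw [← sum_card_filter_lt L fun i => ballot i (#S - 1 - i)]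
  refine sum_congr rfl fun x hx => ?_
  have e1 : ({y ∈ S.erase x | y < x} : Finset α) = {y ∈ L | y < x} := by
    ext y
    simp only [mem_filter, mem_erase]
    exact ⟨fun h => ⟨hlow x hx y h.1.2 h.2, h.2⟩, fun h => ⟨⟨h.2.ne, hL h.1⟩, h.2⟩⟩
  have e2 : ({y ∈ S.erase x | ¬ y < x} : Finset α) = {y ∈ S.erase x | x < y} := by
    refine filter_congr fun y hy => ?_
    rw [not_lt]
    exact ⟨fun h => lt_of_le_of_ne h (mem_erase.1 hy).1.symm, le_of_lt⟩
  have e3 := card_filter_add_card_filter_not (s := S.erase x) (· < x)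
  rw [card_erase_of_mem (hL hx), e2, e1] at e3
  rw [e1]
  congr 1
  omega

open Classical in
theorem card_arrangements_avoids123_cons (S : Finset α) (m : α) (hm : m ∉ S) :
    #{l ∈ arrangements S | Avoids123 (m :: l)} = ballot #{y ∈ S | y < m} #{y ∈ S | m < y} := by
  induction hN : #S generalizing S m with
  | zero =>
    obtain rfl := card_eq_zero.1 hN
    have : arrangements (∅ : Finset α) = {[]} := by
      ext l
      simp only [mem_arrangements, List.toFinset_eq_empty_iff, mem_singleton]
      exact ⟨fun h => h.2, fun h => by simp [h]⟩
    rw [this, filter_true_of_mem (by simp [Avoids123])]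
    simp [ballot_zero_left]
  | succ N ih =>
    have hS : S.Nonempty := card_pos.1 (by omega)
    rw [card_filter_arrangements hS, ← sum_filter_add_sum_filter_not S (· < m)]
    have hU : ({y ∈ S | ¬ y < m} : Finset α) = {y ∈ S | m < y} := by
      refine filter_congr fun y hy => ?_
      rw [not_lt]
      exact ⟨fun h => lt_of_le_of_ne h (fun h' => hm (h' ▸ hy)), le_of_lt⟩
    have hcard := card_filter_add_card_filter_not (s := S) (· < m)
    rw [hU] at hcard ⊢
    have h1 : ∑ x ∈ S with x < m, #{l ∈ arrangements (S.erase x) | Avoids123 (m :: x :: l)} =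
        ∑ i ∈ range #{y ∈ S | y < m}, ballot i (N - i) := by
      rw [show N = #S - 1 by omega, ← sum_ballot_card_erase _ (filter_subset _ _)]
      · refine sum_congr rfl fun x hx => ?_
        obtain ⟨hxS, hxm⟩ := mem_filter.1 hx
        simp only [avoids123_cons_cons_of_lt hxm]
        exact ih _ _ (by simp) (by rw [card_erase_of_mem hxS]; omega)
      · intro x hx y hy hyx
        exact mem_filter.2 ⟨hy, hyx.trans (mem_filter.1 hx).2⟩
    have h2 : ∑ x ∈ S with m < x, #{l ∈ arrangements (S.erase x) | Avoids123 (m :: x :: l)} =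
        if #{y ∈ S | m < y} = 0 then 0 else
          ballot #{y ∈ S | y < m} (#{y ∈ S | m < y} - 1) := by
      split_ifs with h0
      · rw [card_eq_zero.1 h0, sum_empty]
      · have hne : ({y ∈ S | m < y} : Finset α).Nonempty := card_ne_zero.1 h0
        obtain ⟨M, hM, hmax⟩ := Finset.exists_max_image _ id hne
        obtain ⟨hMS, hmM⟩ := mem_filter.1 hM
        rw [sum_eq_single_of_mem M hM]
        · have : {l ∈ arrangements (S.erase M) | Avoids123 (m :: M :: l)} =
              {l ∈ arrangements (S.erase M) | Avoids123 (m :: l)} := by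
            refine filter_congr fun l hl => ?_
            rw [avoids123_cons_cons_of_gt hmM, and_iff_right]
            intro y hy
            rw [← List.mem_toFinset, (mem_arrangements.1 hl).2] at hy
            rcases lt_or_ge m y with h | h
            · exact hmax y (mem_filter.2 ⟨mem_of_mem_erase hy, h⟩)
            · exact h.trans hmM.le
          rw [this, ih _ _ (fun h => hm (mem_of_mem_erase h))
            (by rw [card_erase_of_mem hMS]; omega), filter_erase, filter_erase,
            card_erase_of_mem hM, erase_eq_of_notMem]
          simp [hmM.le]
        · intro x hx hxM
          rw [card_eq_zero, filter_eq_empty_iff]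
          intro l hl
          rw [avoids123_cons_cons_of_gt (mem_filter.1 hx).2]
          rintro ⟨h, -⟩
          have : M ∈ l := by
            rw [← List.mem_toFinset, (mem_arrangements.1 hl).2]
            exact mem_erase.2 ⟨hxM.symm, hMS⟩
          exact hxM (le_antisymm (hmax x hx) (h M this))
    rw [h1, h2]
    generalize #{y ∈ S | y < m} = a at *
    generalize #{y ∈ S | m < y} = b at *
    rcases a with _ | a
    · rcases b with _ | b
      · omega
      · simp [ballot_zero_left]
    · rcases b with _ | b
      · have := sum_range_ballot a 0
        rw [show a + 0 = N by omega] at this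
        simp [this, ballot_succ_zero]
      · have := sum_range_ballot a (b + 1)
        rw [show a + (b + 1) = N by omega] at this
        rw [this, ballot_succ_succ, if_neg (by omega), add_comm]
        rfl

open Classical in
theorem card_arrangements_avoids123 (S : Finset α) :
    #{l ∈ arrangements S | Avoids123 l} = catalan #S := by
  rcases S.eq_empty_or_nonempty with rfl | hS
  · have : arrangements (∅ : Finset α) = {[]} := by
      ext l
      simp only [mem_arrangements, List.toFinset_eq_empty_iff, mem_singleton]
      exact ⟨fun h => h.2, fun h => by simp [h]⟩
    rw [this, filter_true_of_mem (by simp [Avoids123])]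
    simp
  · rw [card_filter_arrangements hS, sum_congr rfl fun x _ =>
      card_arrangements_avoids123_cons (S.erase x) x (by simp),
      sum_ballot_card_erase S subset_rfl fun _ _ _ h _ => h, ← ballot_zero_right]
    obtain ⟨N, hN⟩ : ∃ N, #S = N + 1 := ⟨#S - 1, by have := card_pos.2 hS; omega⟩
    rw [hN, ballot_succ_zero]
    exact sum_range_ballot N 0

end

theorem avoids123_ofFn {α : Type*} [LT α] {k : ℕ} (f : Fin k → α) :
    Avoids123 (List.ofFn f) ↔ ∀ i j l, i < j → j < l → ¬ (f i < f j ∧ f j < f l) := by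
  rw [Avoids123, List.triplewise_iff_getElem]
  simp only [List.length_ofFn, List.getElem_ofFn]
  exact ⟨fun h i j l hij hjl => h i j l hij hjl l.2,
    fun h i j l hij hjl hl => h ⟨i, by omega⟩ ⟨j, by omega⟩ ⟨l, hl⟩ hij hjl⟩

theorem card_embedding_avoids123 (X Y : Type*) [LinearOrder X] [LinearOrder Y]
    [Fintype X] [Fintype Y] :
    Nat.card {f : X ↪ Y // ∀ i j l, i < j → j < l → ¬ (f i < f j ∧ f j < f l)} =
      (Fintype.card Y).choose (Fintype.card X) * catalan (Fintype.card X) := by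
  classical
  set k := Fintype.card X with hk
  let e : Fin k ≃o X := Fintype.orderIsoFinOfCardEq X hk.symm
  let T : Finset (List Y) := (powersetCard k (univ : Finset Y)).biUnion
    fun S => {l ∈ arrangements S | Avoids123 l}
  have hT : #T = (Fintype.card Y).choose k * catalan k := by
    rw [card_biUnion, sum_congr rfl fun S hS => by
      rw [card_arrangements_avoids123, (mem_powersetCard.1 hS).2], sum_const, card_powersetCard,
      smul_eq_mul, card_univ]
    intro S _ S' _ hne
    rw [Function.onFun, disjoint_left]
    intro l hl hl'
    exact hne ((mem_arrangements.1 (mem_filter.1 hl).1).2.symm.trans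
      (mem_arrangements.1 (mem_filter.1 hl').1).2)
  have mem_T (l : List Y) : l ∈ T ↔ l.Nodup ∧ l.length = k ∧ Avoids123 l := by
    simp only [T, mem_biUnion, mem_filter, mem_arrangements, mem_powersetCard_univ]
    constructor
    · rintro ⟨S, hS, ⟨hn, rfl⟩, ha⟩
      exact ⟨hn, by rw [← hS, List.toFinset_card_of_nodup hn], ha⟩
    · rintro ⟨hn, hl, ha⟩
      exact ⟨_, by rw [List.toFinset_card_of_nodup hn, hl], ⟨hn, rfl⟩, ha⟩
  have hT' : Nat.card {l // l ∈ T} = #T := by simp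
  rw [← hT, ← hT']
  refine Nat.card_eq_of_bijective (fun f => ⟨List.ofFn (f.1 ∘ e), ?_⟩) ⟨?_, ?_⟩
  · rw [mem_T, List.nodup_ofFn, avoids123_ofFn]
    refine ⟨f.1.injective.comp e.injective, List.length_ofFn, fun i j l hij hjl => ?_⟩
    exact f.2 _ _ _ (e.lt_iff_lt.2 hij) (e.lt_iff_lt.2 hjl)
  · rintro ⟨f, _⟩ ⟨g, _⟩ h
    have h' := List.ofFn_injective (Subtype.ext_iff.1 h)
    refine Subtype.ext (DFunLike.coe_injective ?_)
    exact e.surjective.injective_comp_right h'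
  · rintro ⟨l, hl⟩
    obtain ⟨hn, hlen, ha⟩ := (mem_T l).1 hl
    clear_value e k
    subst hlen
    have hl' : List.ofFn l.get = l := List.ofFn_get l
    rw [← hl', avoids123_ofFn] at ha
    refine ⟨⟨⟨l.get ∘ e.symm, (List.nodup_iff_injective_get.1 hn).comp e.symm.injective⟩, ?_⟩, ?_⟩
    · intro i j m hij hjm
      exact ha _ _ _ (e.symm.lt_iff_lt.2 hij) (e.symm.lt_iff_lt.2 hjm)
    · refine Subtype.ext (Eq.trans ?_ hl')
      refine congrArg List.ofFn (funext fun i => ?_)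
      simp

theorem card_embedding_avoids123_restrict (X Y : Type*) [LinearOrder X] [LinearOrder Y]
    [Fintype X] [Fintype Y] (V : Y → Prop) [DecidablePred V] :
    Nat.card {f : X ↪ Y // ∀ i j l, i < j → j < l → V (f i) → V (f j) → V (f l) →
      ¬ (f i < f j ∧ f j < f l)} =
    ∑ A : Finset X, (Fintype.card {y // V y}).choose #A * catalan #A *
      (Fintype.card {y // ¬ V y}).descFactorial (Fintype.card X - #A) := by
  classical
  have hA (A : Finset X) : (Fintype.card {y // V y}).choose #A * catalan #A *
      (Fintype.card {y // ¬ V y}).descFactorial (Fintype.card X - #A) =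
      Nat.card ({g : A ↪ {y // V y} // ∀ i j l, i < j → j < l → ¬ (g i < g j ∧ g j < g l)} ×
        ({x // x ∉ A} ↪ {y // ¬ V y})) := by
    have hc : Fintype.card {x // x ∉ A} = Fintype.card X - #A := by
      rw [Fintype.card_subtype_compl, Fintype.card_coe]
    rw [Nat.card_prod, card_embedding_avoids123, Nat.card_eq_fintype_card,
      Fintype.card_embedding_eq, Fintype.card_coe, hc]
  rw [sum_congr rfl fun A _ => hA A, ← Nat.card_sigma]
  symm
  let glue (A : Finset X) (g : A ↪ {y // V y}) (h : {x // x ∉ A} ↪ {y // ¬ V y}) (x : X) : Y :=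
    if hx : x ∈ A then g ⟨x, hx⟩ else h ⟨x, hx⟩
  have glue_pos {A g h x} (hx : x ∈ A) : glue A g h x = g ⟨x, hx⟩ := dif_pos hx
  have glue_neg {A g h x} (hx : x ∉ A) : glue A g h x = h ⟨x, hx⟩ := dif_neg hx
  have glue_mem {A g h x} : V (glue A g h x) ↔ x ∈ A := by
    by_cases hx : x ∈ A
    · simp only [glue_pos hx, hx, (g ⟨x, hx⟩).2]
    · simp only [glue_neg hx, hx, (h ⟨x, hx⟩).2]
  refine Nat.card_eq_of_bijective
    (fun p => ⟨⟨glue p.1 p.2.1.1 p.2.2, fun x x' hxx => ?_⟩, fun i j l hij hjl hi hj hl => ?_⟩)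
    ⟨?_, ?_⟩
  · have hiff : x ∈ p.1 ↔ x' ∈ p.1 := by
      rw [← glue_mem (g := p.2.1.1) (h := p.2.2), hxx, glue_mem]
    by_cases hx : x ∈ p.1
    · rw [glue_pos hx, glue_pos (hiff.1 hx)] at hxx
      exact Subtype.ext_iff.1 (p.2.1.1.injective (Subtype.ext hxx))
    · rw [glue_neg hx, glue_neg (fun h => hx (hiff.2 h))] at hxx
      exact Subtype.ext_iff.1 (p.2.2.injective (Subtype.ext hxx))
  · replace hi := glue_mem.1 hi
    replace hj := glue_mem.1 hj
    replace hl := glue_mem.1 hl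
    change ¬ (glue _ _ _ i < glue _ _ _ j ∧ glue _ _ _ j < glue _ _ _ l)
    rw [glue_pos hi, glue_pos hj, glue_pos hl]
    exact p.2.1.2 ⟨i, hi⟩ ⟨j, hj⟩ ⟨l, hl⟩ hij hjl
  · rintro ⟨A, ⟨g, hg⟩, h⟩ ⟨A', ⟨g', hg'⟩, h'⟩ heq
    have hfun (x : X) : glue A g h x = glue A' g' h' x :=
      DFunLike.congr_fun (Subtype.ext_iff.1 heq) x
    obtain rfl : A = A' := by
      ext x
      rw [← glue_mem (g := g) (h := h), hfun, glue_mem]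
    obtain rfl : g = g' := by
      ext ⟨x, hx⟩
      have := hfun x
      rwa [glue_pos hx, glue_pos hx] at this
    obtain rfl : h = h' := by
      ext ⟨x, hx⟩
      have := hfun x
      rwa [glue_neg hx, glue_neg hx] at this
    rfl
  · rintro ⟨f, hf⟩
    refine ⟨⟨univ.filter fun x => V (f x),
      ⟨⟨fun x => ⟨f x, (mem_filter.1 x.2).2⟩, fun x x' h => ?_⟩, ?_⟩,
      ⟨fun x => ⟨f x, fun h => x.2 (mem_filter.2 ⟨mem_univ _, h⟩)⟩, fun x x' h => ?_⟩⟩, ?_⟩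
    · exact Subtype.ext (f.injective (Subtype.ext_iff.1 h))
    · rintro ⟨i, hi⟩ ⟨j, hj⟩ ⟨l, hl⟩ hij hjl
      exact hf i j l hij hjl (mem_filter.1 hi).2 (mem_filter.1 hj).2 (mem_filter.1 hl).2
    · exact Subtype.ext (f.injective (Subtype.ext_iff.1 h))
    · refine Subtype.ext (DFunLike.ext _ _ fun x => ?_)
      by_cases hx : x ∈ univ.filter fun x => V (f x)
      · exact glue_pos hx
      · exact glue_neg hx

theorem card_perm_extending {Z : Type*} [Fintype Z] (s : Set Z) (f : s ↪ Z) :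
    Nat.card {π : Equiv.Perm Z // ∀ x : s, π x = f x} = (Nat.card (sᶜ : Set Z)).factorial := by
  classical
  refine (Nat.card_congr (Equiv.Set.compl (Equiv.ofInjective f f.injective))).trans ?_
  have h1 : Fintype.card (sᶜ : Set Z) = Fintype.card ((Set.range f)ᶜ : Set Z) := by
    rw [Fintype.card_compl_set, Fintype.card_compl_set,
      Fintype.card_congr (Equiv.ofInjective f f.injective)]
  rw [Nat.card_eq_fintype_card, Nat.card_eq_fintype_card,
    Fintype.card_equiv (Fintype.equivOfCardEq h1)]

theorem card_perm_of_restrict {Z : Type*} [Fintype Z] (s : Set Z) (R : (s ↪ Z) → Prop) :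
    Nat.card {π : Equiv.Perm Z // R ((Function.Embedding.subtype (· ∈ s)).trans π.toEmbedding)} =
      Nat.card {f // R f} * (Nat.card (sᶜ : Set Z)).factorial := by
  classical
  let F (π : {π : Equiv.Perm Z //
      R ((Function.Embedding.subtype (· ∈ s)).trans π.toEmbedding)}) : {f // R f} := ⟨_, π.2⟩
  rw [Nat.card_congr (Equiv.sigmaFiberEquiv F).symm, Nat.card_sigma,
    sum_congr rfl fun f _ => ?_, sum_const, smul_eq_mul, card_univ, ← Nat.card_eq_fintype_card]
  rw [← card_perm_extending s f.1]
  refine Nat.card_eq_of_bijective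
    (fun p => ⟨p.1.1, fun x => DFunLike.congr_fun (Subtype.ext_iff.1 p.2) x⟩) ⟨?_, ?_⟩
  · intro p q h
    have h' := congrArg Subtype.val h
    exact Subtype.ext (Subtype.ext h')
  · rintro ⟨π, hπ⟩
    have : (Function.Embedding.subtype (· ∈ s)).trans π.toEmbedding = f.1 := DFunLike.ext _ _ hπ
    exact ⟨⟨⟨π, by rw [this]; exact f.2⟩, Subtype.ext this⟩, rfl⟩

theorem card_even_fin (n : ℕ) : Fintype.card {i : Fin (2 * n) // Even (i : ℕ)} = n := by
  refine (Fintype.card_congr (β := Fin n) ⟨fun i => ⟨i.1 / 2, by omega⟩,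
    fun i => ⟨⟨2 * i, by omega⟩, by simp⟩, ?_, ?_⟩).trans (Fintype.card_fin n)
  · rintro ⟨i, hi⟩
    ext
    exact Nat.two_mul_div_two_of_even hi
  · intro i
    ext
    simp

theorem card_not_even_fin (n : ℕ) : Fintype.card {i : Fin (2 * n) // ¬ Even (i : ℕ)} = n := by
  rw [Fintype.card_subtype_compl, card_even_fin, Fintype.card_fin]
  omega

/-- Permutations of {1,...,2n} are modeled as `Equiv.Perm (Fin (2*n))`; 1-indexed
odd positions correspond to `Even (i : ℕ)` and 1-indexed even values to
`Odd ((π i : ℕ))`.  We count permutations with no occurrence of the classical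
pattern 123 among even values placed in odd positions; `catalan k` is the k-th
Catalan number. -/
theorem stmt2 (n : ℕ) :
    Nat.card {π : Equiv.Perm (Fin (2 * n)) //
      ¬ ∃ i j l : Fin (2 * n), i < j ∧ j < l ∧
        Even (i : ℕ) ∧ Even (j : ℕ) ∧ Even (l : ℕ) ∧
        Odd ((π i : ℕ)) ∧ Odd ((π j : ℕ)) ∧ Odd ((π l : ℕ)) ∧
        π i < π j ∧ π j < π l} =
    ∑ k ∈ Finset.range (n + 1),
      Nat.factorial n * Nat.factorial (n - k) * (Nat.choose n k) ^ 3 * catalan k := by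
  classical
  have hV : Fintype.card {v : Fin (2 * n) // Odd (v : ℕ)} = n := by
    simp only [← Nat.not_even_iff_odd]
    exact card_not_even_fin n
  have hW : Fintype.card {v : Fin (2 * n) // ¬ Odd (v : ℕ)} = n := by
    simp only [Nat.not_odd_iff_even]
    exact card_even_fin n
  let s : Set (Fin (2 * n)) := {i | Even (i : ℕ)}
  have hs : Fintype.card s = n := card_even_fin n
  have hsc : Nat.card (sᶜ : Set (Fin (2 * n))) = n := by
    rw [Nat.card_eq_fintype_card]
    exact card_not_even_fin n
  have key := card_perm_of_restrict s fun f => ∀ i j l, i < j → j < l → Odd (f i : ℕ) →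
    Odd (f j : ℕ) → Odd (f l : ℕ) → ¬ (f i < f j ∧ f j < f l)
  rw [card_embedding_avoids123_restrict s (Fin (2 * n)) fun v => Odd (v : ℕ), hV, hW, hs, hsc,
    ← powerset_univ, sum_powerset_apply_card
      fun k => n.choose k * catalan k * n.descFactorial (n - k), card_univ, hs, sum_mul] at key
  rw [sum_congr rfl fun k hk => ?_, ← key]
  · refine Nat.card_congr (Equiv.subtypeEquivRight fun π => ?_)
    constructor
    · intro h i j l hij hjl hi hj hl hlt
      exact h ⟨i, j, l, hij, hjl, i.2, j.2, l.2, hi, hj, hl, hlt⟩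
    · rintro h ⟨i, j, l, hij, hjl, hi, hj, hl, hvi, hvj, hvl, hlt⟩
      exact h ⟨i, hi⟩ ⟨j, hj⟩ ⟨l, hl⟩ hij hjl hvi hvj hvl hlt
  · rw [Nat.descFactorial_eq_factorial_mul_choose,
      Nat.choose_symm (Nat.lt_succ_iff.1 (mem_range.1 hk)), smul_eq_mul]
    ring
end

section
/- The map sending 1 ↦ 01, 2 ↦ 00, 3 ↦ 10 is a bijection between words of length n over {1,2,3} avoiding the factor 13 and binary words of length 2n avoiding the factor 11. -/
/-- Letterwise encoding 1 ↦ 01, 2 ↦ 00, 3 ↦ 10.  Letters of {1,2,3} are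
modeled as `Fin 3` (letter `x+1` for `x : Fin 3`); bits as `Fin 2`. -/
def enc (x : Fin 3) : Fin 2 × Fin 2 :=
  if x = 0 then (0, 1) else if x = 1 then (0, 0) else (1, 0)

/-- The inverse of `enc` on the pairs of bits other than `(1, 1)`. -/
def dec (p : Fin 2 × Fin 2) : Fin 3 :=
  if p.1 = 1 then 2 else if p.2 = 1 then 0 else 1

theorem dec_enc (x : Fin 3) : dec (enc x) = x := by
  revert x; decide

theorem enc_dec (p : Fin 2 × Fin 2) (hp : ¬ (p.1 = 1 ∧ p.2 = 1)) : enc (dec p) = p := by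
  revert p; decide

theorem enc_fst_eq_one_iff (x : Fin 3) : ((enc x).1 : ℕ) = 1 ↔ (x : ℕ) = 2 := by
  revert x; decide

theorem enc_snd_eq_one_iff (x : Fin 3) : ((enc x).2 : ℕ) = 1 ↔ (x : ℕ) = 0 := by
  revert x; decide

theorem half_lt {n : ℕ} (j : Fin (2 * n)) : (j : ℕ) / 2 < n := by
  omega

/-- The letterwise concatenated encoding of a word. -/
def encWord {n : ℕ} (w : Fin n → Fin 3) (j : Fin (2 * n)) : Fin 2 :=
  if (j : ℕ) % 2 = 0
  then (enc (w ⟨(j : ℕ) / 2, half_lt j⟩)).1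
  else (enc (w ⟨(j : ℕ) / 2, half_lt j⟩)).2

/-- The `i`-th block of two consecutive bits of a binary word. -/
def bitPair {n : ℕ} (b : Fin (2 * n) → Fin 2) (i : Fin n) : Fin 2 × Fin 2 :=
  (b ⟨2 * i, by have := i.isLt; omega⟩, b ⟨2 * i + 1, by have := i.isLt; omega⟩)

theorem bitPair_encWord {n : ℕ} (w : Fin n → Fin 3) (i : Fin n) :
    bitPair (encWord w) i = enc (w i) := by
  have h : (2 * (i : ℕ) + 1) / 2 = i := by omega
  simp [bitPair, encWord, Nat.add_mod, h]

theorem bitPair_injective {n : ℕ} :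
    Function.Injective (bitPair : (Fin (2 * n) → Fin 2) → Fin n → Fin 2 × Fin 2) := by
  intro b c h
  ext1 j
  have hj := congrFun h ⟨(j : ℕ) / 2, half_lt j⟩
  simp only [bitPair, Prod.mk.injEq] at hj
  rcases Nat.mod_two_eq_zero_or_one j with h0 | h1
  · have e : 2 * ((j : ℕ) / 2) = j := by omega
    simpa only [e] using hj.1
  · have e : 2 * ((j : ℕ) / 2) + 1 = j := by omega
    simpa only [e] using hj.2

theorem encWord_injective {n : ℕ} :
    Function.Injective (encWord : (Fin n → Fin 3) → Fin (2 * n) → Fin 2) := by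
  intro v w h
  ext1 i
  rw [← dec_enc (v i), ← dec_enc (w i), ← bitPair_encWord, ← bitPair_encWord, h]

theorem encWord_dec_bitPair {n : ℕ} (b : Fin (2 * n) → Fin 2)
    (hb : ∀ i, ¬ ((bitPair b i).1 = 1 ∧ (bitPair b i).2 = 1)) :
    encWord (fun i => dec (bitPair b i)) = b := by
  apply bitPair_injective
  ext1 i
  rw [bitPair_encWord, enc_dec _ (hb i)]

/-- The encoding has a factor `11` exactly when the word has a factor `13`. -/
theorem encWord_factor_iff {n : ℕ} (w : Fin n → Fin 3) :
    (∃ i j : Fin (2 * n), (j : ℕ) = (i : ℕ) + 1 ∧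
        (encWord w i : ℕ) = 1 ∧ (encWord w j : ℕ) = 1) ↔
      ∃ i j : Fin n, (j : ℕ) = (i : ℕ) + 1 ∧ (w i : ℕ) = 0 ∧ (w j : ℕ) = 2 := by
  constructor
  · rintro ⟨i, j, hij, hi, hj⟩
    rcases Nat.mod_two_eq_zero_or_one i with h0 | h1
    · have hj0 : (j : ℕ) % 2 ≠ 0 := by omega
      have e : (j : ℕ) / 2 = i / 2 := by omega
      simp only [encWord, h0, hj0, e, if_true, if_false, enc_fst_eq_one_iff,
        enc_snd_eq_one_iff] at hi hj
      omega
    · have hi0 : (i : ℕ) % 2 ≠ 0 := by omega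
      have hj0 : (j : ℕ) % 2 = 0 := by omega
      simp only [encWord, hi0, hj0, if_true, if_false, enc_fst_eq_one_iff,
        enc_snd_eq_one_iff] at hi hj
      exact ⟨_, _, by simp only; omega, hi, hj⟩
  · rintro ⟨i, j, hij, hi, hj⟩
    refine ⟨⟨2 * i + 1, by omega⟩, ⟨2 * j, by omega⟩, by simp only; omega, ?_, ?_⟩
    · change ((bitPair (encWord w) i).2 : ℕ) = 1
      rwa [bitPair_encWord, enc_snd_eq_one_iff]
    · change ((bitPair (encWord w) j).1 : ℕ) = 1
      rwa [bitPair_encWord, enc_fst_eq_one_iff]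

/-- The map sending 1 ↦ 01, 2 ↦ 00, 3 ↦ 10, applied letterwise and
concatenated, is a bijection between words of length `n` over {1,2,3}
avoiding the factor 13 and binary words of length `2n` avoiding the
factor 11. -/
theorem stmt13 (n : ℕ) :
    ∃ f : {w : Fin n → Fin 3 //
            ¬ ∃ i j : Fin n, (j : ℕ) = (i : ℕ) + 1 ∧ (w i : ℕ) = 0 ∧ (w j : ℕ) = 2} ≃
          {b : Fin (2 * n) → Fin 2 //
            ¬ ∃ i j : Fin (2 * n), (j : ℕ) = (i : ℕ) + 1 ∧ (b i : ℕ) = 1 ∧ (b j : ℕ) = 1},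
      ∀ w, ∀ j : Fin (2 * n),
        (f w : Fin (2 * n) → Fin 2) j =
          if (j : ℕ) % 2 = 0
          then (enc (w.1 ⟨(j : ℕ) / 2, by have := j.isLt; omega⟩)).1
          else (enc (w.1 ⟨(j : ℕ) / 2, by have := j.isLt; omega⟩)).2 := by
  refine ⟨Equiv.ofBijective
    (fun w => ⟨encWord w.1, fun h => w.2 ((encWord_factor_iff w.1).1 h)⟩) ⟨?_, ?_⟩,
    fun _ _ => rfl⟩
  · intro v w h
    exact Subtype.ext (encWord_injective (congrArg Subtype.val h))
  · rintro ⟨b, hb⟩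
    have hdec := encWord_dec_bitPair b fun i hi =>
      hb ⟨_, _, rfl, congrArg Fin.val hi.1, congrArg Fin.val hi.2⟩
    refine ⟨⟨fun i => dec (bitPair b i), fun h => hb ?_⟩, Subtype.ext hdec⟩
    rw [← encWord_factor_iff, hdec] at h
    exact h
end
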